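/- Let X be a second countable Stone space, x ∈ X, and Ω a stable clopen neighborhood of x, with a fixed decomposition Ω \ {x} = ⋃_{k≥1} Y_k as guaranteed by stability. Let A ⊆ Ω be a brick and B a subbrick of A. Then for every h ∈ G(B) there exist u, v ∈ G(A) such that h = u ∘ v ∘ u⁻¹ ∘ v⁻¹. -/

import Mathlib

open Pointwise Topology

/-- The group of self-homeomorphisms of a space, with `(f * g) x = f (g x)`. -/
instance homeoGroup (X : Type*) [TopologicalSpace X] : Group (X ≃ₜ X) where
  mul f g := g.trans f
  one := Homeomorph.refl X
  inv := Homeomorph.symm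
  mul_assoc _ _ _ := Homeomorph.ext fun _ => rfl
  one_mul _ := Homeomorph.ext fun _ => rfl
  mul_one _ := Homeomorph.ext fun _ => rfl
  inv_mul_cancel f := Homeomorph.ext fun x => f.symm_apply_apply x

/-- The compact-open topology on the homeomorphism group. -/
instance homeoTop (X : Type*) [TopologicalSpace X] : TopologicalSpace (X ≃ₜ X) :=
  TopologicalSpace.induced (fun f : X ≃ₜ X => (f : C(X, X))) ContinuousMap.compactOpen

/-- `U` is a stable clopen neighborhood of `x`: for every clopen neighborhood `U' ⊆ U` of `x`
there is a homeomorphism `U ≃ₜ U'` fixing `x`. -/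
def IsStableNbhd {X : Type*} [TopologicalSpace X] (x : X) (U : Set X) : Prop :=
  IsClopen U ∧ U ∈ nhds x ∧
    ∀ U' : Set X, U' ⊆ U → IsClopen U' → U' ∈ nhds x →
      ∃ Φ : (U : Set X) ≃ₜ (U' : Set X), ∀ hx : x ∈ U, ((Φ ⟨x, hx⟩ : U') : X) = x

/-- `Y k ↘ x`: every sequence of points chosen from the sets `Y k` converges to `x`. -/
def DescendsTo {X : Type*} [TopologicalSpace X] (Y : ℕ → Set X) (x : X) : Prop :=
  ∀ u : ℕ → X, (∀ k, u k ∈ Y k) → Filter.Tendsto u Filter.atTop (nhds x)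

/-- A decomposition `Ω \ {x} = ⋃ Y k` of a stable neighborhood as guaranteed by stability
(here `Y k` plays the role of `Y_{k+1}` of the paper): the pieces are nonempty, pairwise
disjoint and clopen, they descend to `x`, each `Y (k+1)` contains a clopen copy of `Y k`,
and for every infinite increasing sequence of indices `κ` the space `Ω \ {x}` is
homeomorphic to `⋃ n, Y (κ n)`. -/
structure IsStableDecomp {X : Type*} [TopologicalSpace X] (x : X) (Ω : Set X)
    (Y : ℕ → Set X) : Prop where
  nonempty : ∀ k, (Y k).Nonempty
  clopen : ∀ k, IsClopen (Y k)
  disj : ∀ k l, k ≠ l → Disjoint (Y k) (Y l)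
  union : Ω \ {x} = ⋃ k, Y k
  descends : DescendsTo Y x
  contains : ∀ k, ∃ Z : Set X, Z ⊆ Y (k + 1) ∧ IsClopen Z ∧
    Nonempty ((Y k : Set X) ≃ₜ (Z : Set X))
  subseq : ∀ κ : ℕ → ℕ, StrictMono κ →
    Nonempty (((Ω \ {x} : Set X)) ≃ₜ ((⋃ n, Y (κ n) : Set X)))

/-- A brick relative to the decomposition `Y`: a union `⋃ k ∈ S, Y k` with `S` infinite
and co-infinite. -/
def IsBrick {X : Type*} [TopologicalSpace X] (Y : ℕ → Set X) (B : Set X) : Prop :=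
  ∃ S : Set ℕ, S.Infinite ∧ Sᶜ.Infinite ∧ B = ⋃ k ∈ S, Y k

/-- `B` is a subbrick of the brick `A`, relative to the decomposition `Y`. -/
def IsSubbrick {X : Type*} [TopologicalSpace X] (Y : ℕ → Set X) (A B : Set X) : Prop :=
  ∃ S S' : Set ℕ, S.Infinite ∧ Sᶜ.Infinite ∧ S' ⊆ S ∧ S'.Infinite ∧ (S \ S').Infinite ∧
    A = ⋃ k ∈ S, Y k ∧ B = ⋃ k ∈ S', Y k

/-- `f` is supported on `A`: it is the identity outside `A`. -/
def SuppOn {X : Type*} [TopologicalSpace X] (f : X ≃ₜ X) (A : Set X) : Prop :=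
  ∀ y : X, y ∉ A → f y = y

/-- The set of homeomorphisms of `X` supported on `A`. -/
def suppIn {X : Type*} [TopologicalSpace X] (A : Set X) : Set (X ≃ₜ X) :=
  {f | SuppOn f A}

/-- The union of the first `n` pieces of the decomposition (`Y[n]` in the paper). -/
def blockUnion {X : Type*} [TopologicalSpace X] (Y : ℕ → Set X) (n : ℕ) : Set X :=
  ⋃ i ∈ Finset.range n, Y i

/-- If `f` is an open embedding into a compact Hausdorff space whose range becomes closed on adding
one point outside it, then extending a self-homeomorphism of the domain by the identity gives
a continuous map. -/
theorem continuous_extend_of_isOpenEmbedding {X Z : Type*} [TopologicalSpace X] [CompactSpace X]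
    [T2Space X] [TopologicalSpace Z] {f : Z → X} (hf : IsOpenEmbedding f) {x : X}
    (hx : x ∉ Set.range f) (hcl : IsClosed (insert x (Set.range f))) (θ : Z ≃ₜ Z) :
    Continuous (Function.extend f (f ∘ θ) id) := by
  have happ : ∀ z, Function.extend f (f ∘ θ) id (f z) = f (θ z) :=
    hf.injective.extend_apply _ _
  have hoff : ∀ y, y ∉ Set.range f → Function.extend f (f ∘ θ) id y = y :=
    fun y hy => Function.extend_apply' _ _ _ hy
  rw [continuous_iff_continuousAt]
  intro y
  by_cases hy : y ∈ Set.range f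
  · obtain ⟨z, rfl⟩ := hy
    rw [← hf.continuousAt_iff]
    have : Function.extend f (f ∘ θ) id ∘ f = f ∘ θ := funext happ
    rw [this]
    exact (hf.continuous.comp θ.continuous).continuousAt
  · by_cases hyx : y = x
    · subst hyx
      rw [ContinuousAt, hoff y hy, (nhds_basis_opens y).tendsto_right_iff]
      rintro V ⟨hyV, hV⟩
      have hK : IsCompact (insert y (Set.range f) \ V) := hcl.isCompact.diff hV
      have hKr : insert y (Set.range f) \ V ⊆ Set.range f := by
        rintro a ⟨rfl | ha, haV⟩
        · exact absurd hyV haV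
        · exact ha
      have hK' : IsCompact (f '' (θ ⁻¹' (f ⁻¹' (insert y (Set.range f) \ V)))) := by
        refine IsCompact.image ?_ hf.continuous
        rw [θ.isCompact_preimage]
        exact hf.isInducing.isCompact_preimage' hK hKr
      have hnhds : (f '' (θ ⁻¹' (f ⁻¹' (insert y (Set.range f) \ V))))ᶜ ∈ 𝓝 y := by
        refine hK'.isClosed.isOpen_compl.mem_nhds ?_
        rintro ⟨z, -, hz⟩
        exact hy ⟨z, hz⟩
      filter_upwards [hnhds, hV.mem_nhds hyV] with a ha haV
      by_cases har : a ∈ Set.range f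
      · obtain ⟨z, rfl⟩ := har
        rw [happ]
        by_contra hnV
        exact ha ⟨z, ⟨Or.inr ⟨_, rfl⟩, hnV⟩, rfl⟩
      · rwa [hoff a har]
    · have hev : Function.extend f (f ∘ θ) id =ᶠ[𝓝 y] id := by
        have hmem : (insert x (Set.range f))ᶜ ∈ 𝓝 y :=
          hcl.isOpen_compl.mem_nhds (by simp only [Set.mem_compl_iff, Set.mem_insert_iff]; tauto)
        filter_upwards [hmem] with a ha
        exact hoff a fun h => ha (Or.inr h)
      exact continuousAt_id.congr hev.symm

/-- A self-homeomorphism of the domain of an open embedding extends by the identity to the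
ambient compact Hausdorff space when the range becomes closed on adding one point. -/
theorem exists_homeomorph_extending {X Z : Type*} [TopologicalSpace X] [CompactSpace X]
    [T2Space X] [TopologicalSpace Z] {f : Z → X} (hf : IsOpenEmbedding f) {x : X}
    (hx : x ∉ Set.range f) (hcl : IsClosed (insert x (Set.range f))) (θ : Z ≃ₜ Z) :
    ∃ F : X ≃ₜ X, (∀ z, F (f z) = f (θ z)) ∧ ∀ y, y ∉ Set.range f → F y = y := by
  have happ : ∀ (η : Z ≃ₜ Z) z, Function.extend f (f ∘ η) id (f z) = f (η z) :=
    fun η => hf.injective.extend_apply _ _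
  have hoff : ∀ (η : Z ≃ₜ Z) y, y ∉ Set.range f → Function.extend f (f ∘ η) id y = y :=
    fun η y hy => Function.extend_apply' _ _ _ hy
  have hinv : ∀ η ζ : Z ≃ₜ Z, (∀ z, η (ζ z) = z) → Function.LeftInverse
      (Function.extend f (f ∘ η) id) (Function.extend f (f ∘ ζ) id) := by
    intro η ζ hηζ y
    by_cases hy : y ∈ Set.range f
    · obtain ⟨z, rfl⟩ := hy
      rw [happ, happ, hηζ]
    · rw [hoff ζ y hy, hoff η y hy]
  exact ⟨{  toFun := Function.extend f (f ∘ θ) id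
            invFun := Function.extend f (f ∘ θ.symm) id
            left_inv := hinv _ _ θ.symm_apply_apply
            right_inv := hinv _ _ θ.apply_symm_apply
            continuous_toFun := continuous_extend_of_isOpenEmbedding hf hx hcl θ
            continuous_invFun := continuous_extend_of_isOpenEmbedding hf hx hcl θ.symm },
    happ θ, hoff θ⟩

/-- Open embeddings with disjoint ranges assemble to an open embedding of the
product with a discrete space. -/
theorem isOpenEmbedding_uncurry_of_disjoint {X W I : Type*} [TopologicalSpace X]
    [TopologicalSpace W] [TopologicalSpace I] [DiscreteTopology I] {φ : I → W → X}
    (hφ : ∀ i, IsOpenEmbedding (φ i))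
    (hdisj : ∀ i j, i ≠ j → Disjoint (Set.range (φ i)) (Set.range (φ j))) :
    IsOpenEmbedding (Function.uncurry φ) := by
  refine .of_continuous_injective_isOpenMap ?_ ?_ ?_
  · exact continuous_prod_of_discrete_left.2 fun i => (hφ i).continuous
  · rintro ⟨i, w⟩ ⟨j, w'⟩ h
    have h' : φ i w = φ j w' := h
    obtain rfl : i = j := by
      by_contra hij
      exact Set.disjoint_left.1 (hdisj i j hij) ⟨w, rfl⟩ ⟨w', h'.symm⟩
    rw [(hφ i).injective h']
  · intro U hU
    have hUeq : Function.uncurry φ '' U = ⋃ i, φ i '' (Prod.mk i ⁻¹' U) := by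
      ext y
      simp only [Set.mem_image, Set.mem_iUnion, Set.mem_preimage, Prod.exists, Function.uncurry]
    rw [hUeq]
    exact isOpen_iUnion fun i => (hφ i).isOpenMap _ (hU.preimage (Continuous.prodMk_right i))

/-- A homeomorphism which restricts to the `0`-th of a `ℤ`-indexed family of disjoint copies of
a space and is the identity elsewhere is a commutator of homeomorphisms supported on the union
of the copies, provided that this union becomes closed on adding one point. -/
theorem exists_commutator_of_int_copies {X W : Type*} [TopologicalSpace X] [CompactSpace X]
    [T2Space X] [TopologicalSpace W] {φ : ℤ → W → X} (hφ : IsOpenEmbedding (Function.uncurry φ))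
    {x : X} (hx : x ∉ Set.range (Function.uncurry φ))
    (hcl : IsClosed (insert x (Set.range (Function.uncurry φ))))
    (h : X ≃ₜ X) (hh : SuppOn h (Set.range (φ 0))) :
    ∃ u v : X ≃ₜ X, SuppOn u (Set.range (Function.uncurry φ)) ∧
      SuppOn v (Set.range (Function.uncurry φ)) ∧ h = u * v * u⁻¹ * v⁻¹ := by
  have hφ0 : IsEmbedding (φ 0) :=
    hφ.isEmbedding.comp (isEmbedding_prodMkRight (0 : ℤ))
  have hmaps : ∀ y, y ∈ Set.range (φ 0) ↔ h y ∈ Set.range (φ 0) := by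
    refine fun y => ⟨fun hy => ?_, fun hy => ?_⟩
    · by_contra hn
      exact hn ((h.injective (hh _ hn)).symm ▸ hy)
    · by_contra hn
      exact hn (hh y hn ▸ hy)
  let g : W ≃ₜ W :=
    (hφ0.toHomeomorph.trans (h.subtype hmaps)).trans hφ0.toHomeomorph.symm
  have hg : ∀ w, φ 0 (g w) = h (φ 0 w) := fun w =>
    congrArg Subtype.val (hφ0.toHomeomorph.apply_symm_apply (h.subtype hmaps
      (hφ0.toHomeomorph w)))
  let G : ℤ → (W ≃ₜ W) := fun i => if 0 ≤ i then g else Homeomorph.refl W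
  let θv : ℤ × W ≃ₜ ℤ × W :=
    { toFun := fun p => (p.1, G p.1 p.2)
      invFun := fun p => (p.1, (G p.1).symm p.2)
      left_inv := fun p => Prod.ext rfl ((G p.1).symm_apply_apply p.2)
      right_inv := fun p => Prod.ext rfl ((G p.1).apply_symm_apply p.2)
      continuous_toFun := continuous_prod_of_discrete_left.2 fun i =>
        continuous_const.prodMk (G i).continuous
      continuous_invFun := continuous_prod_of_discrete_left.2 fun i =>
        continuous_const.prodMk (G i).symm.continuous }
  let θu : ℤ × W ≃ₜ ℤ × W := (Homeomorph.addRight (1 : ℤ)).prodCongr (Homeomorph.refl W)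
  obtain ⟨u, hu, hu'⟩ := exists_homeomorph_extending hφ hx hcl θu
  obtain ⟨v, hv, hv'⟩ := exists_homeomorph_extending hφ hx hcl θv
  replace hu : ∀ i w, u (φ i w) = φ (i + 1) w := fun i w => hu (i, w)
  replace hv : ∀ i w, v (φ i w) = φ i (G i w) := fun i w => hv (i, w)
  have hfix : ∀ i w, i ≠ 0 → h (φ i w) = φ i w := by
    rintro i w hi
    refine hh _ ?_
    rintro ⟨w', hw'⟩
    exact hi (congrArg Prod.fst (hφ.injective (a₁ := (0, w')) (a₂ := (i, w)) hw')).symm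
  have key : h * u * v = v * u := by
    ext y
    change h (u (v y)) = v (u y)
    by_cases hy : y ∈ Set.range (Function.uncurry φ)
    · obtain ⟨⟨i, w⟩, rfl⟩ := hy
      change h (u (v (φ i w))) = v (u (φ i w))
      rw [hv, hu, hu, hv]
      obtain hi | rfl | hi : 0 ≤ i ∨ i = -1 ∨ i < -1 := by omega
      · rw [hfix _ _ (by omega)]
        simp only [G, if_pos hi, if_pos (show 0 ≤ i + 1 by omega)]
      · simp [G, hg]
      · rw [hfix _ _ (by omega)]
        simp only [G, if_neg (show ¬ 0 ≤ i by omega), if_neg (show ¬ 0 ≤ i + 1 by omega)]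
    · rw [hv' y hy, hu' y hy, hv' y hy]
      exact hh y fun ⟨w, hw⟩ => hy ⟨(0, w), hw⟩
  refine ⟨v, u, hv', hu', ?_⟩
  rw [← key]
  group

/-- A set of naturals containing a subset with infinite complement in it splits into infinite
pieces indexed by `ℤ`, the `0`-th one being the given subset. -/
theorem exists_int_partition {S S' : Set ℕ} (hsub : S' ⊆ S) (hS' : S'.Infinite)
    (hdiff : (S \ S').Infinite) :
    ∃ T : ℤ → Set ℕ, T 0 = S' ∧ (∀ i, (T i).Infinite) ∧ (∀ i j, i ≠ j → Disjoint (T i) (T j)) ∧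
      ⋃ i, T i = S := by
  have := hdiff.to_subtype
  obtain ⟨e⟩ : Nonempty ((S \ S' : Set ℕ) ≃ ({i : ℤ // i ≠ 0} × ℕ)) := by
    have : Infinite ({i : ℤ // i ≠ 0} × ℕ) :=
      have : Nonempty {i : ℤ // i ≠ 0} := ⟨⟨1, one_ne_zero⟩⟩
      inferInstance
    exact nonempty_equiv_of_countable
  have hlab : ∀ k : ℕ, ∃ i : ℤ, (k ∈ S' → i = 0) ∧
      ∀ hk : k ∈ S \ S', i = (e ⟨k, hk⟩).1.1 := by
    intro k
    by_cases hk : k ∈ S \ S'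
    · exact ⟨(e ⟨k, hk⟩).1.1, fun h => absurd h hk.2, fun _ => rfl⟩
    · exact ⟨0, fun _ => rfl, fun h => absurd h hk⟩
  choose c hc0 hc using hlab
  refine ⟨fun i => {k ∈ S | c k = i}, ?_, ?_, ?_, ?_⟩
  · ext k
    refine ⟨fun ⟨hkS, hk⟩ => ?_, fun hk => ⟨hsub hk, hc0 k hk⟩⟩
    by_contra hn
    exact (e ⟨k, hkS, hn⟩).1.2 ((hc k ⟨hkS, hn⟩).symm.trans hk)
  · intro i
    by_cases hi : i = 0
    · exact hS'.mono fun k hk => ⟨hsub hk, (hc0 k hk).trans hi.symm⟩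
    · refine (Set.infinite_range_of_injective (f := fun n : ℕ => (e.symm (⟨i, hi⟩, n) : ℕ))
        fun m n hmn => ?_).mono ?_
      · exact congrArg Prod.snd (e.symm.injective (Subtype.ext hmn))
      · rintro _ ⟨n, rfl⟩
        refine ⟨(e.symm (⟨i, hi⟩, n)).2.1, ?_⟩
        rw [hc _ (e.symm (⟨i, hi⟩, n)).2]
        simp
  · intro i j hij
    exact Set.disjoint_left.2 fun k hk hk' => hij (hk.2.symm.trans hk'.2)
  · ext k
    simp

namespace IsStableDecomp

variable {X : Type*} [TopologicalSpace X] {x : X} {Ω : Set X} {Y : ℕ → Set X}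

theorem notMem (hY : IsStableDecomp x Ω Y) (k : ℕ) : x ∉ Y k := fun h =>
  (hY.union.symm.subset (Set.mem_iUnion_of_mem k h)).2 rfl

theorem disjoint_biUnion (hY : IsStableDecomp x Ω Y) {S T : Set ℕ} (hST : Disjoint S T) :
    Disjoint (⋃ k ∈ S, Y k) (⋃ k ∈ T, Y k) := by
  simp only [Set.disjoint_iUnion_left, Set.disjoint_iUnion_right]
  intro k hk l hl
  exact hY.disj _ _ fun hkl => Set.disjoint_left.1 hST hl (hkl ▸ hk)

theorem isClosed_insert_biUnion (hY : IsStableDecomp x Ω Y) (hΩ : IsClosed Ω) (hx : x ∈ Ω)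
    (S : Set ℕ) : IsClosed (insert x (⋃ k ∈ S, Y k)) := by
  have heq : insert x (⋃ k ∈ S, Y k) = Ω \ ⋃ k ∈ Sᶜ, Y k := by
    have hΩeq : Ω = insert x (⋃ k, Y k) := by
      rw [← hY.union, Set.insert_sdiff_singleton, Set.insert_eq_of_mem hx]
    have hcover : (⋃ k, Y k) = (⋃ k ∈ S, Y k) ∪ ⋃ k ∈ Sᶜ, Y k := by
      rw [← Set.biUnion_union, Set.union_compl_self, Set.biUnion_univ]
    have hxn : x ∉ ⋃ k ∈ Sᶜ, Y k := by
      simp only [Set.mem_iUnion, not_exists]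
      exact fun k _ => hY.notMem k
    rw [hΩeq, hcover, Set.insert_sdiff_of_notMem _ hxn, Set.union_sdiff_right,
      (hY.disjoint_biUnion disjoint_compl_right).sdiff_eq_left]
  rw [heq]
  exact hΩ.sdiff (isOpen_biUnion fun k _ => (hY.clopen k).isOpen)

theorem exists_isOpenEmbedding_range_eq (hY : IsStableDecomp x Ω Y) {T : Set ℕ}
    (hT : T.Infinite) :
    ∃ φ : (Ω \ {x} : Set X) → X, IsOpenEmbedding φ ∧ Set.range φ = ⋃ k ∈ T, Y k := by
  obtain ⟨e⟩ := hY.subseq (Nat.nth (· ∈ T)) (Nat.nth_strictMono hT)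
  have hopen : IsOpen (⋃ n, Y (Nat.nth (· ∈ T) n)) :=
    isOpen_iUnion fun n => (hY.clopen _).isOpen
  refine ⟨Subtype.val ∘ e, hopen.isOpenEmbedding_subtypeVal.comp e.isOpenEmbedding, ?_⟩
  have hnth : Set.range (Nat.nth (· ∈ T)) = T := Nat.range_nth_of_infinite hT
  rw [Set.range_comp, e.range_coe, Set.image_univ, Subtype.range_coe,
    ← Set.biUnion_range (f := Nat.nth (· ∈ T)) (g := Y), hnth]

/-- A homeomorphism supported on a union of pieces that omits infinitely many pieces fixes the
limit point. -/
theorem apply_eq_of_suppOn [T2Space X] (hY : IsStableDecomp x Ω Y) {S : Set ℕ}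
    (hS : Sᶜ.Infinite) {h : X ≃ₜ X} (hh : SuppOn h ((⋃ k ∈ S, Y k) ∪ {x})) : h x = x := by
  choose a ha using hY.nonempty
  have hlim := (hY.descends a ha).comp (Nat.nth_strictMono hS).tendsto_atTop
  refine tendsto_nhds_unique ((h.continuous.tendsto x).comp hlim) (hlim.congr fun n => ?_)
  have hn : Nat.nth (· ∈ Sᶜ) n ∉ S := Nat.nth_mem_of_infinite hS n
  have hxn : a (Nat.nth (· ∈ Sᶜ) n) ≠ x := fun hax => hY.notMem _ (hax ▸ ha _)
  refine (hh _ fun hmem => hmem.elim (fun hmem => ?_) hxn).symm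
  obtain ⟨k, hk, hak⟩ := Set.mem_iUnion₂.1 hmem
  exact Set.disjoint_left.1 (hY.disj k _ fun hkn => hn (hkn.subst (motive := (· ∈ S)) hk))
    hak (ha _)

end IsStableDecomp

/-- Lemma 3.13 (Anderson trick): every homeomorphism supported on a subbrick `B` of a brick
`A` is a commutator of homeomorphisms supported on `A ∪ {x}`. -/
theorem anderson_commutator (X : Type*) [TopologicalSpace X] [CompactSpace X]
    [TopologicalSpace.MetrizableSpace X] [TotallyDisconnectedSpace X] [Nonempty X]
    (x : X) (Ω : Set X) (hΩ : IsStableNbhd x Ω) (Y : ℕ → Set X)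
    (hY : IsStableDecomp x Ω Y)
    (A B : Set X) (hA : IsBrick Y A) (hAB : IsSubbrick Y A B)
    (h : X ≃ₜ X) (hh : SuppOn h (B ∪ {x})) :
    ∃ u v : X ≃ₜ X, SuppOn u (A ∪ {x}) ∧ SuppOn v (A ∪ {x}) ∧
      h = u * v * u⁻¹ * v⁻¹ := by
  obtain ⟨S, S', -, -, hsub, hS', hdiff, rfl, rfl⟩ := hAB
  obtain ⟨T, hT0, hTinf, hTdisj, hTS⟩ := exists_int_partition hsub hS' hdiff
  choose φ hφ hrange using fun i => hY.exists_isOpenEmbedding_range_eq (hTinf i)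
  have hemb := isOpenEmbedding_uncurry_of_disjoint hφ fun i j hij => by
    rw [hrange, hrange]
    exact hY.disjoint_biUnion (hTdisj i j hij)
  have hun : Set.range (Function.uncurry φ) = ⋃ k ∈ S, Y k := by
    rw [← hTS, Set.biUnion_iUnion]
    simp only [← hrange]
    ext y
    simp [Function.uncurry]
  have hx : x ∉ Set.range (Function.uncurry φ) := by
    rw [hun]
    simp only [Set.mem_iUnion, not_exists]
    exact fun k _ => hY.notMem k
  have hcl : IsClosed (insert x (Set.range (Function.uncurry φ))) :=
    hun ▸ hY.isClosed_insert_biUnion hΩ.1.isClosed (mem_of_mem_nhds hΩ.2.1) S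
  have hhx : h x = x := hY.apply_eq_of_suppOn
    (hdiff.mono fun k hk => hk.2) hh
  have hsupp : SuppOn h (Set.range (φ 0)) := by
    intro y hy
    rw [hrange, hT0] at hy
    by_cases hyx : y = x
    · rw [hyx, hhx]
    · exact hh y fun hmem => hmem.elim hy hyx
  obtain ⟨u, v, hu, hv, huv⟩ := exists_commutator_of_int_copies hemb hx hcl h hsupp
  rw [hun] at hu hv
  exact ⟨u, v, fun y hy => hu y fun h => hy (Or.inl h), fun y hy => hv y fun h => hy (Or.inl h),
    huv⟩
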